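/- Let $T_{q_0} = \langle X_n, Q_T, \pi_T, \lambda_T \rangle$ be a minimal, one-way synchronizing initial transducer representing a homeomorphism of $\mathfrak{C}_n$, with inverse $S_{(\epsilon,q_0)}$. Then $V_n^{T_{q_0}^{-1}} = \mathcal{H}(TS)$, where $V_n^{T_{q_0}^{-1}} = T_{q_0} V_n T_{q_0}^{-1}$. -/

import Mathlib

open Classical

noncomputable section

/-- `n`-ary Cantor space: infinite words over the alphabet `Fin n`. -/
abbrev Cantor (n : ℕ) : Type := ℕ → Fin n

/-- The finite word `w` is a prefix of the infinite word `χ`. -/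
def PrefixOf {n : ℕ} (w : List (Fin n)) (χ : Cantor n) : Prop :=
  ∀ (i : ℕ) (h : i < w.length), w.get ⟨i, h⟩ = χ i

/-- Concatenation of a finite word with an infinite word. -/
def appendInf {n : ℕ} (w : List (Fin n)) (χ : Cantor n) : Cantor n :=
  fun i => if h : i < w.length then w.get ⟨i, h⟩ else χ (i - w.length)

/-- The cone (basic clopen set) of infinite words having the finite word `w` as prefix. -/
def cone {n : ℕ} (w : List (Fin n)) : Set (Cantor n) :=
  {χ | PrefixOf w χ}

/-- The length-`k` prefix of an infinite word, as a finite word. -/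
def takeW {n : ℕ} (χ : Cantor n) (k : ℕ) : List (Fin n) :=
  List.ofFn (fun i : Fin k => χ i)

/-- A finite family of finite words forming a maximal antichain:
every infinite word has exactly one member of the family as a prefix. -/
def AntichainFam {n m : ℕ} (α : Fin m → List (Fin n)) : Prop :=
  ∀ χ : Cantor n, ∃! i : Fin m, PrefixOf (α i) χ

/-- The group structure on self-homeomorphisms of a topological space,
with `f * g` acting as `g` followed by `f`. -/
instance homeoGroup {X : Type*} [TopologicalSpace X] : Group (X ≃ₜ X) where
  mul f g := g.trans f
  one := Homeomorph.refl X
  inv := Homeomorph.symm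
  mul_assoc a b c := Homeomorph.ext fun _ => rfl
  one_mul a := Homeomorph.ext fun _ => rfl
  mul_one a := Homeomorph.ext fun _ => rfl
  inv_mul_cancel a := Homeomorph.ext fun x => a.symm_apply_apply x

/-- The Higman–Thompson group `Vₙ`, as the set of self-homeomorphisms of Cantor space
which act by exchanging finite prefixes along a pair of maximal antichains. -/
def Vn (n : ℕ) : Set (Cantor n ≃ₜ Cantor n) :=
  {g | ∃ (m : ℕ) (α β : Fin m → List (Fin n)), AntichainFam α ∧ AntichainFam β ∧
      ∀ (i : Fin m) (χ : Cantor n), g (appendInf (α i) χ) = appendInf (β i) χ}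

/-- Conjugation in the paper's right-action convention: `paperConj g v = g⁻¹ v g`,
i.e. the homeomorphism `x ↦ (x) g⁻¹ v g` (first apply `g⁻¹`, then `v`, then `g`). -/
def paperConj {n : ℕ} (g v : Cantor n ≃ₜ Cantor n) : Cantor n ≃ₜ Cantor n :=
  (g.symm.trans v).trans g

/-- `l` is the longest common prefix of the set `A` of infinite words. -/
def IsLCP {n : ℕ} (A : Set (Cantor n)) (l : List (Fin n)) : Prop :=
  (∀ ρ ∈ A, PrefixOf l ρ) ∧
    ∀ l' : List (Fin n), (∀ ρ ∈ A, PrefixOf l' ρ) → l'.length ≤ l.length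

/-- A (not necessarily finite-state) transducer over the alphabet `Fin n`. -/
structure Transducer (n : ℕ) where
  /-- the set of states -/
  Q : Type
  /-- the transition function -/
  tr : Fin n → Q → Q
  /-- the output (rewrite) function -/
  out : Fin n → Q → List (Fin n)

namespace Transducer

variable {n : ℕ}

/-- The transition function extended to finite words. -/
def transStar (T : Transducer n) : List (Fin n) → T.Q → T.Q
  | [], q => q
  | x :: w, q => T.transStar w (T.tr x q)

/-- The output function extended to finite words. -/
def outStar (T : Transducer n) : List (Fin n) → T.Q → List (Fin n)
  | [], _ => []
  | x :: w, q => T.out x q ++ T.outStar w (T.tr x q)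

/-- The initial transducer `T_q` induces the map `f` on Cantor space: the outputs along
ever longer prefixes of `χ` are ever longer prefixes of `f χ`. -/
def Induces (T : Transducer n) (q : T.Q) (f : Cantor n → Cantor n) : Prop :=
  ∀ (χ : Cantor n) (m : ℕ), ∃ k : ℕ,
    m ≤ (T.outStar (takeW χ k) q).length ∧ PrefixOf (T.outStar (takeW χ k) q) (f χ)

/-- The image of the state `q`: the image of Cantor space under the map induced by `T_q`. -/
def stateImage (T : Transducer n) (q : T.Q) : Set (Cantor n) :=
  {y | ∃ (f : Cantor n → Cantor n) (χ : Cantor n), T.Induces q f ∧ f χ = y}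

/-- `T` is synchronizing at level `k`: the state reached after reading any word of
length `k` does not depend on the starting state. -/
def SyncAtLevel (T : Transducer n) (k : ℕ) : Prop :=
  ∀ w : List (Fin n), w.length = k → ∀ q q' : T.Q, T.transStar w q = T.transStar w q'

/-- `T` is synchronizing if it is synchronizing at some level. -/
def Synchronizing (T : Transducer n) : Prop := ∃ k, T.SyncAtLevel k

/-- `T` (inducing the homeomorphism `h` at `q0`) is one-way synchronizing: `T` is
synchronizing, but the inverse homeomorphism is not induced by any finite
synchronizing transducer (equivalently, the inverse transducer is not synchronizing). -/
def OneWaySync (T : Transducer n) (q0 : T.Q) (h : Cantor n ≃ₜ Cantor n) : Prop :=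
  T.Induces q0 ⇑h ∧ T.Synchronizing ∧
    ¬ ∃ (S : Transducer n) (_ : Finite S.Q) (s0 : S.Q),
        S.Induces s0 ⇑h.symm ∧ S.Synchronizing

/-- `T` is equal to its core : every state is reached by reading a word of length `k`
from some state, for every synchronizing level `k`. -/
def EqualToCore (T : Transducer n) : Prop :=
  ∀ k : ℕ, T.SyncAtLevel k → ∀ q : T.Q, ∃ (w : List (Fin n)) (p : T.Q),
    w.length = k ∧ T.transStar w p = q

/-- Every state of `T` is accessible from `q0`. -/
def Accessible (T : Transducer n) (q0 : T.Q) : Prop :=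
  ∀ q : T.Q, ∃ w : List (Fin n), T.transStar w q0 = q

/-- The product transducer `T S` (first act by `T`, then by `S`). -/
def prod (T S : Transducer n) : Transducer n where
  Q := T.Q × S.Q
  tr := fun x p => (T.tr x p.1, S.transStar (T.out x p.1) p.2)
  out := fun x p => S.outStar (T.out x p.1) p.2

/-- `T` is partially invertible: every state induces an injective map on Cantor space
with clopen image. -/
def PartiallyInvertible (T : Transducer n) : Prop :=
  ∀ q : T.Q, ∃ f : Cantor n → Cantor n,
    T.Induces q f ∧ Function.Injective f ∧ IsClopen (Set.range f)

/-- `T` has no states of incomplete response: for each state `q` and letter `i`, no word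
strictly longer than `λ(i,q)` is a common prefix of the outputs on all of the cone `[i]`. -/
def NoIncompleteResponse (T : Transducer n) : Prop :=
  ∀ (q : T.Q) (i x : Fin n),
    ¬ ∀ χ : Cantor n, ∃ k : ℕ, (T.out i q ++ [x]) <+: T.outStar (i :: takeW χ k) q

/-- States `q` of `T` and `p` of `S` are `ω`-equivalent: they induce one and the same
map on Cantor space. -/
def OmegaEq (T : Transducer n) (q : T.Q) (S : Transducer n) (p : S.Q) : Prop :=
  ∃ f : Cantor n → Cantor n, T.Induces q f ∧ S.Induces p f

/-- `T` is minimal: no states of incomplete response and no pair of distinct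
`ω`-equivalent states. -/
def Minimal (T : Transducer n) : Prop :=
  T.NoIncompleteResponse ∧ ∀ q q' : T.Q, T.OmegaEq q T q' → q = q'

/-- The map on Cantor space induced by the state `q` (junk value if none exists). -/
def inducedMap (T : Transducer n) (q : T.Q) : Cantor n → Cantor n :=
  if h : ∃ f, T.Induces q f then h.choose else id

/-- `𝓛_q(α)`: the longest common prefix of the preimage of the cone `[α]` under `T_q`
(junk value if it does not exist). -/
def lcp (T : Transducer n) (q : T.Q) (α : List (Fin n)) : List (Fin n) :=
  if h : ∃ l, IsLCP {ρ : Cantor n | T.inducedMap q ρ ∈ cone α} l then h.choose else []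

/-- The inverse transducer of `T` given by the inversion algorithm, on the set of all
pairs `(w, q)`: reading `x` from `(w,q)` outputs `𝓛_q(wx)` and moves to
`(wx - λ(𝓛_q(wx), q), π(𝓛_q(wx), q))`. -/
def invT (T : Transducer n) : Transducer n where
  Q := List (Fin n) × T.Q
  tr := fun x p =>
    ((p.1 ++ [x]).drop (T.outStar (T.lcp p.2 (p.1 ++ [x])) p.2).length,
      T.transStar (T.lcp p.2 (p.1 ++ [x])) p.2)
  out := fun x p => T.lcp p.2 (p.1 ++ [x])

/-- Restriction of a transducer to a set of states (transitions leaving the set are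
replaced by junk loops; for transition-closed sets this is the honest restriction). -/
def restrictTo (T : Transducer n) (P : T.Q → Prop) : Transducer n where
  Q := {q : T.Q // P q}
  tr := fun x q => if h : P (T.tr x q.1) then ⟨T.tr x q.1, h⟩ else q
  out := fun x q => T.out x q.1

/-- The set of states reachable from `q0`. -/
def reach (T : Transducer n) (q0 : T.Q) : T.Q → Prop :=
  fun q => ∃ w : List (Fin n), T.transStar w q0 = q

/-- The inverse transducer of the initial transducer `T_{q0}`, with state set the states
accessible from `(ε, q0)`. -/
def invAcc (T : Transducer n) (q0 : T.Q) : Transducer n :=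
  (T.invT).restrictTo ((T.invT).reach ([], q0))

/-- A pair `(w,p)` is good if `[w] ⊆ im(T_p)` and `𝓛_p(w) = ε`. -/
def GoodPair (T : Transducer n) (p : List (Fin n) × T.Q) : Prop :=
  cone p.1 ⊆ T.stateImage p.2 ∧
    IsLCP {ρ : Cantor n | T.inducedMap p.2 ρ ∈ cone p.1} []

/-- The partial inverse `T'` of a partially invertible transducer `T`: the inverse
transducer restricted to the good pairs `(w,p)` with `[w] ⊆ im(T_p)`, `𝓛_p(w) = ε`. -/
def partialInv (T : Transducer n) : Transducer n :=
  (T.invT).restrictTo T.GoodPair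

/-- `h` is a completion of `T`: there are a maximal antichain `η` and an effective viable
combination `(ρ, p)` such that `h` maps `η_i χ` to `ρ_i (χ)T_{p_i}`. -/
def IsCompletion (T : Transducer n) (h : Cantor n ≃ₜ Cantor n) : Prop :=
  ∃ (l : ℕ) (η ρ : Fin l → List (Fin n)) (p : Fin l → T.Q)
      (f : Fin l → (Cantor n → Cantor n)),
    l % (n - 1) = 1 % (n - 1) ∧
    AntichainFam η ∧
    (∀ i, T.Induces (p i) (f i)) ∧
    (⋃ i, appendInf (ρ i) '' Set.range (f i)) = Set.univ ∧
    (∀ i j, i ≠ j →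
      Disjoint (appendInf (ρ i) '' Set.range (f i))
        (appendInf (ρ j) '' Set.range (f j))) ∧
    ∀ (i : Fin l) (χ : Cantor n), h (appendInf (η i) χ) = appendInf (ρ i) (f i χ)

/-- The group `𝓗(T)` generated by all completions of `T`. -/
def HGroup (T : Transducer n) : Subgroup (Cantor n ≃ₜ Cantor n) :=
  Subgroup.closure {h | T.IsCompletion h}

/-- The subgroup-generating equivalence relation induced by the automaton underlying a
transducer `A` with start state `a0` (by Lemma 4.1, two words are related iff the states
they reach are identified by the collapsing procedure, i.e. iff the reached states
transition identically on all sufficiently long words). -/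
def simA (A : Transducer n) (a0 : A.Q) (α β : List (Fin n)) : Prop :=
  ∃ i : ℕ, ∀ w : List (Fin n), w.length = i →
    A.transStar w (A.transStar α a0) = A.transStar w (A.transStar β a0)

/-- `if b then T else T'`. -/
def factor (T : Transducer n) (b : Bool) : Transducer n :=
  if b then T else T.partialInv

/-- The product of a nonempty list of factors, each equal to `T` or its partial
inverse `T'`; these products make up the set `Π(T)`. -/
def prodOf (T : Transducer n) : List Bool → Transducer n
  | [] => T
  | [b] => T.factor b
  | b :: c :: rest => (T.factor b).prod (T.prodOf (c :: rest))

/-- `T` is contracting: every state of every product of copies of `T` and `T'` is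
`ω`-equivalent to an initial transducer which, after reading some fixed length of input,
always acts as a state of `T`. -/
def Contracting (T : Transducer n) : Prop :=
  ∀ L : List Bool, L ≠ [] → ∀ q : (T.prodOf L).Q,
    ∃ (V : Transducer n) (p : V.Q) (f : Cantor n → Cantor n),
      (T.prodOf L).Induces q f ∧ V.Induces p f ∧
      ∃ j : ℕ, ∀ w : List (Fin n), w.length = j →
        ∃ (u : T.Q) (g : Cantor n → Cantor n),
          V.Induces (V.transStar w p) g ∧ T.Induces u g

end Transducer

/-- The element `v` of `Vₙ` preserves the relation `r` on nonempty finite words: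
whenever `v` replaces the prefix `α` by `β`, the words `α` and `β` are related. -/
def PreservesRel {n : ℕ} (r : List (Fin n) → List (Fin n) → Prop)
    (g : Cantor n ≃ₜ Cantor n) : Prop :=
  ∀ (α β : List (Fin n)), α ≠ [] → β ≠ [] →
    (∀ χ : Cantor n, g (appendInf α χ) = appendInf β χ) → r α β

/-- The subgroup `V_∼` of `Vₙ` generated by the prefix-exchange homeomorphisms
preserving the relation `r`. -/
def VSim (n : ℕ) (r : List (Fin n) → List (Fin n) → Prop) :
    Subgroup (Cantor n ≃ₜ Cantor n) :=
  Subgroup.closure {g | g ∈ Vn n ∧ PreservesRel r g}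

/-- `f` coincides with `g` on the cone `[α]` (conjugated into the cone) and is the
identity off the cone: the homeomorphism `[α]_g`. -/
def IsRestrTo {n : ℕ} (α : List (Fin n)) (g f : Cantor n ≃ₜ Cantor n) : Prop :=
  (∀ χ : Cantor n, f (appendInf α χ) = appendInf α (g χ)) ∧
  ∀ χ : Cantor n, ¬ PrefixOf α χ → f χ = χ

/-- The Nekrashevych group `Vₙ(G)`: the group generated by `Vₙ` together with all the
homeomorphisms `[α]_g` for `g ∈ G`. -/
def NekG (n : ℕ) (G : Subgroup (Cantor n ≃ₜ Cantor n)) :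
    Subgroup (Cantor n ≃ₜ Cantor n) :=
  Subgroup.closure (Vn n ∪ {f | ∃ (α : List (Fin n)) (g : Cantor n ≃ₜ Cantor n),
    g ∈ G ∧ IsRestrTo α g f})

/-- The homeomorphism `f` locally agrees with the set `G` of homeomorphisms. -/
def LocallyAgrees {n : ℕ} (G : Set (Cantor n ≃ₜ Cantor n))
    (f : Cantor n ≃ₜ Cantor n) : Prop :=
  ∀ x : Cantor n, ∃ U : Set (Cantor n), IsOpen U ∧ x ∈ U ∧
    ∃ g ∈ G, Set.EqOn ⇑f ⇑g U

/-- A finite synchronous invertible transducer over `Fin n`: each state rewrites single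
letters to single letters bijectively. -/
structure SyncTransducer (n : ℕ) where
  /-- the set of states -/
  Q : Type
  /-- there are finitely many states -/
  fin : Finite Q
  /-- the transition function -/
  tr : Fin n → Q → Q
  /-- the (single-letter) output function -/
  out : Fin n → Q → Fin n
  /-- each state rewrites letters bijectively -/
  bij : ∀ q : Q, Function.Bijective fun x => out x q

namespace SyncTransducer

variable {n : ℕ}

/-- The transition function extended to finite words. -/
def trStar (U : SyncTransducer n) : List (Fin n) → U.Q → U.Q
  | [], q => q
  | x :: w, q => U.trStar w (U.tr x q)

/-- The output function extended to finite words. -/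
def outWord (U : SyncTransducer n) : List (Fin n) → U.Q → List (Fin n)
  | [], _ => []
  | x :: w, q => U.out x q :: U.outWord w (U.tr x q)

/-- The map on Cantor space induced by the initial transducer `U_q`. -/
def applyFun (U : SyncTransducer n) (q : U.Q) (χ : Cantor n) : Cantor n :=
  fun i => U.out (χ i) (U.trStar (takeW χ i) q)

/-- The inverse transducer of a synchronous invertible transducer. -/
def inv (U : SyncTransducer n) : SyncTransducer n where
  Q := U.Q
  fin := U.fin
  tr := fun y q => U.tr ((Equiv.ofBijective _ (U.bij q)).symm y) q
  out := fun y q => (Equiv.ofBijective _ (U.bij q)).symm y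
  bij := fun q => (Equiv.ofBijective _ (U.bij q)).symm.bijective

/-- The product of synchronous transducers (first act by `T`, then by `S`). -/
def sprod (T S : SyncTransducer n) : SyncTransducer n where
  Q := T.Q × S.Q
  fin := by
    haveI := T.fin; haveI := S.fin
    infer_instance
  tr := fun x p => (T.tr x p.1, S.tr (T.out x p.1) p.2)
  out := fun x p => S.out (T.out x p.1) p.2
  bij := fun p => (S.bij p.2).comp (T.bij p.1)

/-- `U` is synchronizing at level `k`. -/
def SyncAtLevel (U : SyncTransducer n) (k : ℕ) : Prop :=
  ∀ w : List (Fin n), w.length = k → ∀ q q' : U.Q, U.trStar w q = U.trStar w q'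

/-- `U` is synchronizing. -/
def Synchronizing (U : SyncTransducer n) : Prop := ∃ k, U.SyncAtLevel k

/-- `U` is minimal (under `ω`-equivalence): distinct states induce distinct maps. -/
def Minimal (U : SyncTransducer n) : Prop :=
  ∀ q q' : U.Q, U.applyFun q = U.applyFun q' → q = q'

/-- One-way synchronizing: `U` is synchronizing but the inverse homeomorphism of
`h = U_{q0}` is not induced by any finite synchronizing transducer. -/
def OneWaySync (U : SyncTransducer n) (h : Cantor n ≃ₜ Cantor n) : Prop :=
  U.Synchronizing ∧
    ¬ ∃ (S : Transducer n) (_ : Finite S.Q) (s0 : S.Q),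
        S.Induces s0 ⇑h.symm ∧ S.Synchronizing

/-- `U` is equal to its core. -/
def EqualToCore (U : SyncTransducer n) : Prop :=
  ∀ k : ℕ, U.SyncAtLevel k → ∀ q : U.Q, ∃ (w : List (Fin n)) (p : U.Q),
    w.length = k ∧ U.trStar w p = q

/-- The underlying (asynchronous-format) transducer of a synchronous transducer. -/
def toT (U : SyncTransducer n) : Transducer n :=
  ⟨U.Q, U.tr, fun x q => [U.out x q]⟩

/-- The automaton group `𝒢(U)` generated by `U`: the subgroup of the homeomorphism
group of Cantor space generated by the homeomorphisms `U_q` for the states `q`. -/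
def autG (U : SyncTransducer n) : Subgroup (Cantor n ≃ₜ Cantor n) :=
  Subgroup.closure {f : Cantor n ≃ₜ Cantor n | ∃ q : U.Q, ⇑f = U.applyFun q}

end SyncTransducer

/-- The infinite word `χ` with its first `k` letters removed. -/
def shiftW {n : ℕ} (k : ℕ) (χ : Cantor n) : Cantor n := fun i => χ (i + k)

section Words

variable {n : ℕ}

lemma shiftW_appendInf (w : List (Fin n)) (χ : Cantor n) :
    shiftW w.length (appendInf w χ) = χ := by
  funext i
  simp [shiftW, appendInf]

lemma appendInf_append (a b : List (Fin n)) (χ : Cantor n) :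
    appendInf (a ++ b) χ = appendInf a (appendInf b χ) := by
  funext i
  simp only [appendInf, List.length_append, List.get_eq_getElem]
  by_cases h1 : i < a.length
  · have h2 : i < a.length + b.length := by omega
    simp [h1, h2]
  · by_cases h2 : i - a.length < b.length
    · have h3 : i < a.length + b.length := by omega
      simp [h1, h2, h3, List.getElem_append]
    · have h3 : ¬ i < a.length + b.length := by omega
      simp [h1, h2, h3, Nat.sub_sub]

lemma appendInf_nil (χ : Cantor n) : appendInf [] χ = χ := by
  funext i
  simp [appendInf]

lemma shiftW_add (a b : ℕ) (χ : Cantor n) : shiftW (a + b) χ = shiftW b (shiftW a χ) := by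
  funext i
  simp only [shiftW]
  congr 1
  omega

lemma prefixOf_appendInf (w : List (Fin n)) (χ : Cantor n) : PrefixOf w (appendInf w χ) := by
  intro i h
  simp [appendInf, h]

lemma PrefixOf.eq_appendInf {w : List (Fin n)} {χ : Cantor n} (h : PrefixOf w χ) :
    χ = appendInf w (shiftW w.length χ) := by
  funext i
  simp only [appendInf, shiftW]
  split_ifs with hi
  · exact (h i hi).symm
  · congr 1
    omega

lemma length_takeW (χ : Cantor n) (k : ℕ) : (takeW χ k).length = k := by simp [takeW]

lemma prefixOf_takeW (χ : Cantor n) (k : ℕ) : PrefixOf (takeW χ k) χ := by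
  intro i h
  simp [takeW]

lemma appendInf_takeW (χ : Cantor n) (k : ℕ) : appendInf (takeW χ k) (shiftW k χ) = χ := by
  conv_rhs => rw [(prefixOf_takeW χ k).eq_appendInf, length_takeW]

lemma PrefixOf.takeW_eq {w : List (Fin n)} {χ : Cantor n} (h : PrefixOf w χ) :
    takeW χ w.length = w := by
  apply List.ext_getElem
  · simp [takeW]
  · intro i h1 h2
    have := h i h2
    simpa [takeW] using this.symm

lemma takeW_add (χ : Cantor n) (a b : ℕ) :
    takeW χ (a + b) = takeW χ a ++ takeW (shiftW a χ) b := by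
  have h : PrefixOf (takeW χ a ++ takeW (shiftW a χ) b) χ := by
    have := prefixOf_appendInf (takeW χ a ++ takeW (shiftW a χ) b) (shiftW b (shiftW a χ))
    rwa [appendInf_append, appendInf_takeW, appendInf_takeW] at this
  simpa [length_takeW] using h.takeW_eq

lemma takeW_appendInf (u : List (Fin n)) (χ : Cantor n) (k : ℕ) :
    takeW (appendInf u χ) (u.length + k) = u ++ takeW χ k := by
  rw [takeW_add, shiftW_appendInf, (prefixOf_appendInf u χ).takeW_eq]

lemma PrefixOf.of_append {a b : List (Fin n)} {χ : Cantor n} (h : PrefixOf (a ++ b) χ) :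
    PrefixOf a χ := by
  rw [h.eq_appendInf, appendInf_append]
  exact prefixOf_appendInf _ _

lemma prefixOf_append_iff (a b : List (Fin n)) (χ : Cantor n) :
    PrefixOf (a ++ b) (appendInf a χ) ↔ PrefixOf b χ := by
  constructor
  · intro h
    have h1 := congrArg (shiftW a.length) h.eq_appendInf
    rw [appendInf_append, shiftW_appendInf, shiftW_appendInf] at h1
    rw [h1]
    exact prefixOf_appendInf _ _
  · intro h
    rw [h.eq_appendInf, ← appendInf_append]
    exact prefixOf_appendInf _ _

lemma PrefixOf.prefix_of_length_le {a b : List (Fin n)} {χ : Cantor n} (ha : PrefixOf a χ)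
    (hb : PrefixOf b χ) (hl : a.length ≤ b.length) : ∃ t, b = a ++ t := by
  obtain ⟨d, hd⟩ := Nat.exists_eq_add_of_le hl
  refine ⟨takeW (shiftW a.length χ) d, ?_⟩
  rw [← hb.takeW_eq, hd, takeW_add, ha.takeW_eq]

lemma PrefixOf.apply_eq {w : List (Fin n)} {χ ψ : Cantor n} (h : PrefixOf w χ)
    (h' : PrefixOf w ψ) {i : ℕ} (hi : i < w.length) : χ i = ψ i :=
  (h i hi).symm.trans (h' i hi)

lemma eq_of_prefixes {χ ψ : Cantor n}
    (h : ∀ m, ∃ w : List (Fin n), m ≤ w.length ∧ PrefixOf w χ ∧ PrefixOf w ψ) : χ = ψ := by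
  funext i
  obtain ⟨w, hw, h1, h2⟩ := h (i + 1)
  exact h1.apply_eq h2 hw

lemma continuous_shiftW (k : ℕ) : Continuous (shiftW k : Cantor n → Cantor n) :=
  continuous_pi fun i => continuous_apply (i + k)

lemma isOpen_cone (w : List (Fin n)) : IsOpen (cone w) := by
  have : cone w = ⋂ i : Fin w.length, {χ : Cantor n | w.get i = χ i} := by
    ext χ
    simp only [cone, PrefixOf, Set.mem_ofPred_eq, Set.mem_iInter]
    exact ⟨fun h i => h i i.2, fun h i hi => h ⟨i, hi⟩⟩
  rw [this]
  refine isOpen_iInter_of_finite fun i => ?_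
  have := (isOpen_discrete {w.get i}).preimage (continuous_apply (A := fun _ => Fin n) (i : ℕ))
  convert this using 1
  ext χ
  exact eq_comm

lemma cone_mem_nhds {w : List (Fin n)} {χ : Cantor n} (h : PrefixOf w χ) : cone w ∈ nhds χ :=
  (isOpen_cone w).mem_nhds h

/-- The cones of the finite prefixes of `χ` form a neighbourhood base of `χ`. -/
lemma exists_cone_subset {χ : Cantor n} {V : Set (Cantor n)} (hV : V ∈ nhds χ) :
    ∃ k, cone (takeW χ k) ⊆ V := by
  rw [nhds_pi, Filter.mem_pi] at hV
  obtain ⟨I, hI, t, ht, hsub⟩ := hV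
  obtain ⟨k, hk⟩ := hI.bddAbove
  refine ⟨k + 1, fun ψ hψ => hsub fun i hi => ?_⟩
  have hik : i < (takeW χ (k + 1)).length := by
    rw [length_takeW]
    exact Nat.lt_succ_of_le (hk hi)
  have : χ i = ψ i := (prefixOf_takeW χ (k + 1)).apply_eq hψ hik
  rw [← this]
  exact mem_of_mem_nhds (ht i)

/-- A property of words inherited by extensions and eventually true along every infinite word
is true of all sufficiently long words. -/
lemma exists_uniform_length {P : List (Fin n) → Prop} (hext : ∀ a b, P a → P (a ++ b))
    (hP : ∀ χ : Cantor n, ∃ k, P (takeW χ k)) : ∃ L, ∀ χ : Cantor n, P (takeW χ L) := by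
  choose k hk using hP
  obtain ⟨t, -, ht⟩ := isCompact_univ.elim_nhds_subcover (fun χ => cone (takeW χ (k χ)))
    (fun χ _ => cone_mem_nhds (prefixOf_takeW χ (k χ)))
  refine ⟨t.sup k, fun χ => ?_⟩
  obtain ⟨ψ, hψ, hχ⟩ := Set.mem_iUnion₂.1 (ht (Set.mem_univ χ))
  obtain ⟨s, hs⟩ := PrefixOf.prefix_of_length_le hχ (prefixOf_takeW χ (t.sup k))
    (by simpa [length_takeW] using Finset.le_sup hψ)
  rw [hs]
  exact hext _ _ (hk ψ)

/-- The family of all words of length `L`. -/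
def wordFam (n L : ℕ) (i : Fin (n ^ L)) : List (Fin n) := List.ofFn (finFunctionFinEquiv.symm i)

lemma length_wordFam (L : ℕ) (i : Fin (n ^ L)) : (wordFam n L i).length = L := by
  simp [wordFam]

lemma antichainFam_wordFam (n L : ℕ) : AntichainFam (wordFam n L) := by
  intro χ
  have hχ : wordFam n L (finFunctionFinEquiv fun i => χ i) = takeW χ L := by
    simp [wordFam, takeW]
  refine ⟨finFunctionFinEquiv fun i => χ i, ?_, fun j hj => ?_⟩
  · show PrefixOf _ _
    rw [hχ]
    exact prefixOf_takeW χ L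
  have h1 := PrefixOf.takeW_eq hj
  rw [length_wordFam, ← hχ] at h1
  exact finFunctionFinEquiv.symm.injective (List.ofFn_injective h1.symm)

lemma exists_takeW_eq_wordFam (hn : 2 ≤ n) (L : ℕ) (i : Fin (n ^ L)) :
    ∃ χ : Cantor n, takeW χ L = wordFam n L i := by
  refine ⟨appendInf (wordFam n L i) fun _ => ⟨0, by omega⟩, ?_⟩
  simpa [length_wordFam] using
    (prefixOf_appendInf (wordFam n L i) fun _ => (⟨0, by omega⟩ : Fin n)).takeW_eq

end Words

section TailEq

variable {n : ℕ}

/-- Near the point `x`, the values of `F` and `G` agree after deleting prefixes of fixed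
lengths. -/
def TailEq (x : Cantor n) (F G : Cantor n → Cantor n) : Prop :=
  ∃ a b : ℕ, ∀ᶠ z in nhds x, shiftW a (F z) = shiftW b (G z)

lemma TailEq.of_eventually {x : Cantor n} {F G : Cantor n → Cantor n} (w : List (Fin n))
    (h : ∀ᶠ z in nhds x, F z = appendInf w (G z)) : TailEq x F G :=
  ⟨w.length, 0, h.mono fun z hz => by rw [hz, shiftW_appendInf]; rfl⟩

lemma TailEq.symm {x : Cantor n} {F G : Cantor n → Cantor n} (h : TailEq x F G) :
    TailEq x G F := by
  obtain ⟨a, b, h⟩ := h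
  exact ⟨b, a, h.mono fun z hz => hz.symm⟩

lemma TailEq.trans {x : Cantor n} {F G H : Cantor n → Cantor n} (h : TailEq x F G)
    (h' : TailEq x G H) : TailEq x F H := by
  obtain ⟨a, b, h⟩ := h
  obtain ⟨c, d, h'⟩ := h'
  refine ⟨a + c, d + b, (h.and h').mono fun z hz => ?_⟩
  rw [shiftW_add, hz.1, ← shiftW_add, add_comm b c, shiftW_add, hz.2, ← shiftW_add]

lemma TailEq.comp {x : Cantor n} {F G φ : Cantor n → Cantor n} (h : TailEq (φ x) F G)
    (hφ : Continuous φ) : TailEq x (F ∘ φ) (G ∘ φ) := by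
  obtain ⟨a, b, h⟩ := h
  exact ⟨a, b, hφ.continuousAt.eventually h⟩

/-- A homeomorphism which locally only changes prefixes lies in `Vₙ`. -/
lemma mem_Vn_of_tailEq (hn : 2 ≤ n) (v : Cantor n ≃ₜ Cantor n) (hv : ∀ y, TailEq y v id) :
    v ∈ Vn n := by
  have key : ∃ L, ∀ y : Cantor n, ∃ β, ∀ χ, v (appendInf (takeW y L) χ) = appendInf β χ := by
    refine exists_uniform_length (P := fun α => ∃ β, ∀ χ, v (appendInf α χ) = appendInf β χ)
      ?_ fun y => ?_
    · rintro a b ⟨β, hβ⟩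
      exact ⟨β ++ b, fun χ => by rw [appendInf_append, hβ, appendInf_append]⟩
    · obtain ⟨a, b, hab⟩ := hv y
      have hc : ∀ᶠ z in nhds y, v z ∈ cone (takeW (v y) a) :=
        v.continuous.continuousAt.eventually (cone_mem_nhds (prefixOf_takeW (v y) a))
      obtain ⟨k, hk⟩ := exists_cone_subset (hab.and hc)
      refine ⟨b + k, takeW (v y) a ++ takeW (shiftW b y) k, fun χ => ?_⟩
      set z := appendInf (takeW y (b + k)) χ with hz
      have hzk : z ∈ cone (takeW y k) := by
        have : PrefixOf (takeW y (b + k)) z := prefixOf_appendInf _ _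
        rw [add_comm, takeW_add] at this
        exact this.of_append
      obtain ⟨h1, h2⟩ := hk hzk
      rw [PrefixOf.eq_appendInf h2, length_takeW, h1, hz, takeW_add, appendInf_append,
        appendInf_append]
      congr 1
      exact (congrArg (fun j => shiftW j _) (length_takeW y b).symm).trans
        (shiftW_appendInf _ _)
  obtain ⟨L, hL⟩ := key
  have hex : ∀ i : Fin (n ^ L), ∃ β, ∀ χ, v (appendInf (wordFam n L i) χ) = appendInf β χ := by
    intro i
    obtain ⟨y, hy⟩ := exists_takeW_eq_wordFam hn L i
    rw [← hy]
    exact hL y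
  choose β hβ using hex
  refine ⟨n ^ L, wordFam n L, β, antichainFam_wordFam n L, fun χ => ?_, hβ⟩
  have hpre : ∀ i, PrefixOf (β i) χ → PrefixOf (wordFam n L i) (v.symm χ) := by
    intro i hi
    rw [hi.eq_appendInf, ← hβ, v.symm_apply_apply]
    exact prefixOf_appendInf _ _
  obtain ⟨i, hi, huniq⟩ := antichainFam_wordFam n L (v.symm χ)
  refine ⟨i, ?_, fun j hj => huniq j (hpre j hj)⟩
  have : χ = v (v.symm χ) := (v.apply_symm_apply χ).symm
  show PrefixOf (β i) χ
  rw [this, PrefixOf.eq_appendInf hi, hβ]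
  exact prefixOf_appendInf _ _

end TailEq

section LCP

variable {n : ℕ}

lemma exists_isLCP {A : Set (Cantor n)} (hA : A.Nontrivial) : ∃ l, IsLCP A l := by
  obtain ⟨ρ, hρ, σ, hσ, hne⟩ := hA
  obtain ⟨i, hi⟩ := Function.ne_iff.1 hne
  have hbound : ∀ l : List (Fin n), (∀ τ ∈ A, PrefixOf l τ) → l.length ≤ i := by
    intro l hl
    by_contra! hlt
    exact hi ((hl ρ hρ).apply_eq (hl σ hσ) hlt)
  let p : ℕ → Prop := fun k => ∃ l : List (Fin n), (∀ τ ∈ A, PrefixOf l τ) ∧ l.length = k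
  have h0 : p 0 := ⟨[], fun τ _ j hj => absurd hj (by simp), rfl⟩
  obtain ⟨l, hl, hlen⟩ : p (Nat.findGreatest p i) := Nat.findGreatest_spec (Nat.zero_le i) h0
  exact ⟨l, hl, fun l' hl' => hlen ▸ Nat.le_findGreatest (hbound l' hl') ⟨l', hl', rfl⟩⟩

lemma IsLCP.appendInf_image {A : Set (Cantor n)} {m : List (Fin n)} (hA : A.Nonempty)
    (h : IsLCP A m) (l : List (Fin n)) : IsLCP (appendInf l '' A) (l ++ m) := by
  constructor
  · rintro _ ⟨ρ, hρ, rfl⟩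
    exact (prefixOf_append_iff l m ρ).2 (h.1 ρ hρ)
  · intro l' hl'
    rcases le_total l'.length l.length with hle | hle
    · simp only [List.length_append]
      omega
    · obtain ⟨ρ, hρ⟩ := hA
      obtain ⟨t, rfl⟩ := (prefixOf_appendInf l ρ).prefix_of_length_le
        (hl' _ ⟨ρ, hρ, rfl⟩) hle
      have := h.2 t fun σ hσ => (prefixOf_append_iff l t σ).1 (hl' _ ⟨σ, hσ, rfl⟩)
      simpa using this

/-- A word which is a prefix of every infinite word in a cone is a prefix of the word defining
the cone. -/
lemma exists_append_of_cone (hn : 2 ≤ n) {a w : List (Fin n)} (h : ∀ χ ∈ cone w, PrefixOf a χ) :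
    ∃ t, w = a ++ t := by
  have key : ∀ c : Fin n, PrefixOf a (appendInf w fun _ => c) :=
    fun c => h _ (prefixOf_appendInf _ _)
  refine (key ⟨0, by omega⟩).prefix_of_length_le (prefixOf_appendInf _ _) ?_
  by_contra! hlt
  have := (key ⟨0, by omega⟩).apply_eq (χ := appendInf w fun _ => ⟨0, by omega⟩)
    (ψ := appendInf w fun _ => ⟨1, by omega⟩) (key ⟨1, by omega⟩) hlt
  simp [appendInf] at this

lemma cone_nontrivial (hn : 2 ≤ n) (w : List (Fin n)) : (cone w).Nontrivial := by
  refine ⟨appendInf w fun _ => ⟨0, by omega⟩, prefixOf_appendInf _ _,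
    appendInf w fun _ => ⟨1, by omega⟩, prefixOf_appendInf _ _, fun h => ?_⟩
  have := congrFun (congrArg (shiftW w.length) h) 0
  simp [shiftW_appendInf] at this

lemma preimage_cone_nontrivial (hn : 2 ≤ n) {f : Cantor n → Cantor n} {w : List (Fin n)}
    (h : cone w ⊆ Set.range f) : (f ⁻¹' cone w).Nontrivial := by
  obtain ⟨_, hx, _, hy, hne⟩ := cone_nontrivial hn w
  obtain ⟨ρ, rfl⟩ := h hx
  obtain ⟨σ, rfl⟩ := h hy
  exact ⟨ρ, hx, σ, hy, fun e => hne (congrArg f e)⟩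

end LCP

namespace Transducer

section Basic

variable {n : ℕ} {T S : Transducer n}

lemma transStar_append (u w : List (Fin n)) (q : T.Q) :
    T.transStar (u ++ w) q = T.transStar w (T.transStar u q) := by
  induction u generalizing q with
  | nil => rfl
  | cons x u ih => exact ih _

lemma outStar_append (u w : List (Fin n)) (q : T.Q) :
    T.outStar (u ++ w) q = T.outStar u q ++ T.outStar w (T.transStar u q) := by
  induction u generalizing q with
  | nil => rfl
  | cons x u ih => simp [outStar, transStar, ih]

lemma outStar_takeW_of_le {k k' : ℕ} (hk : k ≤ k') (χ : Cantor n) (q : T.Q) :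
    ∃ t, T.outStar (takeW χ k') q = T.outStar (takeW χ k) q ++ t := by
  obtain ⟨d, rfl⟩ := Nat.exists_eq_add_of_le hk
  exact ⟨_, by rw [takeW_add, outStar_append]⟩

lemma length_outStar_takeW_mono {k k' : ℕ} (hk : k ≤ k') (χ : Cantor n) (q : T.Q) :
    (T.outStar (takeW χ k) q).length ≤ (T.outStar (takeW χ k') q).length := by
  obtain ⟨t, ht⟩ := outStar_takeW_of_le hk χ q
  simp [ht]

lemma Induces.prefixOf {q : T.Q} {f : Cantor n → Cantor n} (h : T.Induces q f) (χ : Cantor n)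
    (k : ℕ) : PrefixOf (T.outStar (takeW χ k) q) (f χ) := by
  obtain ⟨k', hlen, hpre⟩ := h χ (T.outStar (takeW χ k) q).length
  obtain ⟨t, ht⟩ := outStar_takeW_of_le (le_max_left k k') χ q
  obtain ⟨t', ht'⟩ := outStar_takeW_of_le (le_max_right k k') χ q
  have hp : T.outStar (takeW χ k) q <+: T.outStar (takeW χ k') q :=
    List.prefix_of_prefix_length_le ⟨t, ht.symm⟩ ⟨t', ht'.symm⟩ hlen
  obtain ⟨s, hs⟩ := hp
  rw [← hs] at hpre
  exact hpre.of_append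

lemma Induces.unique {q : T.Q} {f g : Cantor n → Cantor n} (hf : T.Induces q f)
    (hg : T.Induces q g) : f = g := by
  funext χ
  refine eq_of_prefixes fun m => ?_
  obtain ⟨k, hlen, hpre⟩ := hf χ m
  exact ⟨_, hlen, hpre, hg.prefixOf χ k⟩

lemma Induces.prefixOf_outStar {q : T.Q} {f : Cantor n → Cantor n} (h : T.Induces q f)
    (u : List (Fin n)) (χ : Cantor n) : PrefixOf (T.outStar u q) (f (appendInf u χ)) := by
  have := h.prefixOf (appendInf u χ) u.length
  rwa [(prefixOf_appendInf u χ).takeW_eq] at this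

lemma Induces.transStar {q : T.Q} {f : Cantor n → Cantor n} (h : T.Induces q f)
    (u : List (Fin n)) : T.Induces (T.transStar u q)
      fun χ => shiftW (T.outStar u q).length (f (appendInf u χ)) := by
  intro χ m
  obtain ⟨k, hlen, -⟩ := h (appendInf u χ) ((T.outStar u q).length + m)
  have h1 := length_outStar_takeW_mono (Nat.le_add_left k u.length) (appendInf u χ) q
  have h2 := h.prefixOf (appendInf u χ) (u.length + k)
  rw [takeW_appendInf, outStar_append] at h1 h2
  rw [List.length_append] at h1
  refine ⟨k, by omega, ?_⟩
  rw [(h.prefixOf_outStar u χ).eq_appendInf, prefixOf_append_iff] at h2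
  exact h2

lemma Induces.apply_appendInf {q : T.Q} {f g : Cantor n → Cantor n} (hf : T.Induces q f)
    (u : List (Fin n)) (hg : T.Induces (T.transStar u q) g) (χ : Cantor n) :
    f (appendInf u χ) = appendInf (T.outStar u q) (g χ) := by
  rw [hg.unique (hf.transStar u)]
  exact (hf.prefixOf_outStar u χ).eq_appendInf

lemma Induces.continuous {q : T.Q} {f : Cantor n → Cantor n} (h : T.Induces q f) :
    Continuous f := by
  refine continuous_iff_continuousAt.2 fun χ V hV => ?_
  obtain ⟨m, hm⟩ := exists_cone_subset hV
  obtain ⟨k, hlen, hpre⟩ := h χ m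
  refine Filter.mem_map.2 (Filter.mem_of_superset (cone_mem_nhds (prefixOf_takeW χ k))
    fun ψ hψ => hm ?_)
  have h1 : PrefixOf (T.outStar (takeW χ k) q) (f ψ) := by
    have := h.prefixOf ψ k
    have h2 := PrefixOf.takeW_eq hψ
    rw [length_takeW] at h2
    rwa [h2] at this
  obtain ⟨t, ht⟩ := (prefixOf_takeW (f χ) m).prefix_of_length_le hpre
    (by rwa [length_takeW])
  rw [ht] at h1
  exact h1.of_append

lemma outStar_prod (w : List (Fin n)) (q : T.Q) (s : S.Q) :
    (T.prod S).outStar w (q, s) = S.outStar (T.outStar w q) s := by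
  induction w generalizing q s with
  | nil => rfl
  | cons x w ih =>
    show S.outStar (T.out x q) s ++ (T.prod S).outStar w (T.tr x q, S.transStar (T.out x q) s) = _
    rw [ih, outStar, outStar_append]

lemma Induces.prod {q : T.Q} {s : S.Q} {f g : Cantor n → Cantor n} (hf : T.Induces q f)
    (hg : S.Induces s g) : (T.prod S).Induces (q, s) (g ∘ f) := by
  intro χ m
  obtain ⟨j, hj, -⟩ := hg (f χ) m
  obtain ⟨k, hk, hpre⟩ := hf χ j
  refine ⟨k, ?_, ?_⟩
  · rw [outStar_prod, ← hpre.takeW_eq]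
    exact hj.trans (length_outStar_takeW_mono hk (f χ) s)
  · rw [outStar_prod, ← hpre.takeW_eq]
    exact hg.prefixOf _ _

lemma inducedMap_eq {q : T.Q} {f : Cantor n → Cantor n} (h : T.Induces q f) :
    T.inducedMap q = f := by
  have hex : ∃ f, T.Induces q f := ⟨f, h⟩
  rw [inducedMap, dif_pos hex]
  exact hex.choose_spec.unique h

/-- In a synchronizing transducer any two states induce maps which locally differ only by
prefixes. -/
lemma Synchronizing.tailEq (hT : T.Synchronizing) {q q' : T.Q} {f f' : Cantor n → Cantor n}
    (hf : T.Induces q f) (hf' : T.Induces q' f') (χ : Cantor n) : TailEq χ f f' := by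
  obtain ⟨k, hk⟩ := hT
  have hs := hk (takeW χ k) (length_takeW χ k) q q'
  have key : ∀ {p : T.Q} {e : Cantor n → Cantor n}, T.Induces p e →
      ∀ {g : Cantor n → Cantor n}, T.Induces (T.transStar (takeW χ k) p) g →
      TailEq χ e (g ∘ shiftW k) := by
    intro p e he g hg
    refine .of_eventually (T.outStar (takeW χ k) p) ?_
    filter_upwards [cone_mem_nhds (prefixOf_takeW χ k)] with z hz
    have h1 := PrefixOf.eq_appendInf hz
    rw [length_takeW] at h1
    conv_lhs => rw [h1]
    exact he.apply_appendInf _ hg _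
  exact (key hf (hf.transStar _)).trans (key hf' (hs ▸ hf.transStar _)).symm

end Basic

section Restrict

variable {n : ℕ} {T : Transducer n}

lemma restrictTo_tr {P : T.Q → Prop} (hP : ∀ x q, P q → P (T.tr x q)) (x : Fin n)
    (q : (T.restrictTo P).Q) : ((T.restrictTo P).tr x q).1 = T.tr x q.1 := by
  simp [restrictTo, hP x q.1 q.2]

lemma restrictTo_outStar {P : T.Q → Prop} (hP : ∀ x q, P q → P (T.tr x q)) (w : List (Fin n))
    (q : (T.restrictTo P).Q) : (T.restrictTo P).outStar w q = T.outStar w q.1 := by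
  induction w generalizing q with
  | nil => rfl
  | cons x w ih => rw [outStar, outStar, ih, restrictTo_tr hP]; rfl

lemma reach_tr {q0 : T.Q} (x : Fin n) (q : T.Q) (h : T.reach q0 q) : T.reach q0 (T.tr x q) := by
  obtain ⟨w, rfl⟩ := h
  exact ⟨w ++ [x], transStar_append _ _ _⟩

end Restrict

section Inverse

variable {n : ℕ} {T : Transducer n}

/-- The state `(w, q)` of the inverse transducer inverts `T_q` on the cone of `w`. -/
def InvState (T : Transducer n) (s : List (Fin n) × T.Q) : Prop :=
  cone s.1 ⊆ Set.range (T.inducedMap s.2)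

lemma isLCP_lcp (hn : 2 ≤ n) {q : T.Q} {w : List (Fin n)}
    (hs : cone w ⊆ Set.range (T.inducedMap q)) :
    IsLCP (T.inducedMap q ⁻¹' cone w) (T.lcp q w) := by
  have hex : ∃ l, IsLCP {ρ | T.inducedMap q ρ ∈ cone w} l :=
    exists_isLCP (preimage_cone_nontrivial hn hs)
  rw [lcp, dif_pos hex]
  exact hex.choose_spec

lemma InvState.cone_append {s : List (Fin n) × T.Q} (hs : T.InvState s) (u : List (Fin n)) :
    cone (s.1 ++ u) ⊆ Set.range (T.inducedMap s.2) :=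
  fun _ hχ => hs (PrefixOf.of_append hχ)

lemma InvState.eq_append (hn : 2 ≤ n) (hT : ∀ q, T.Induces q (T.inducedMap q))
    {s : List (Fin n) × T.Q} (hs : T.InvState s) (x : Fin n) :
    s.1 ++ [x] = T.outStar (T.invT.out x s) s.2 ++ (T.invT.tr x s).1 := by
  have hl := isLCP_lcp hn (hs.cone_append [x])
  obtain ⟨t, ht⟩ := exists_append_of_cone hn
    (a := T.outStar (T.invT.out x s) s.2) (w := s.1 ++ [x]) fun χ hχ => by
      obtain ⟨ρ, rfl⟩ := hs.cone_append [x] hχ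
      rw [(hl.1 ρ hχ).eq_appendInf]
      exact (hT s.2).prefixOf_outStar _ _
  have : (T.invT.tr x s).1 = t := by
    show (s.1 ++ [x]).drop (T.outStar (T.invT.out x s) s.2).length = t
    rw [ht]
    simp
  rw [this, ht]

lemma InvState.preimage_cone (hn : 2 ≤ n) (hT : ∀ q, T.Induces q (T.inducedMap q))
    {s : List (Fin n) × T.Q} (hs : T.InvState s) (x : Fin n) (u : List (Fin n)) :
    T.inducedMap s.2 ⁻¹' cone (s.1 ++ x :: u) =
      appendInf (T.invT.out x s) ''
        (T.inducedMap (T.invT.tr x s).2 ⁻¹' cone ((T.invT.tr x s).1 ++ u)) := by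
  have hl := isLCP_lcp hn (hs.cone_append [x])
  have heq : s.1 ++ x :: u =
      T.outStar (T.invT.out x s) s.2 ++ ((T.invT.tr x s).1 ++ u) := by
    rw [← List.append_assoc, ← hs.eq_append hn hT x]
    simp
  have hmem : ∀ ρ, appendInf (T.invT.out x s) ρ ∈ T.inducedMap s.2 ⁻¹' cone (s.1 ++ x :: u) ↔
      ρ ∈ T.inducedMap (T.invT.tr x s).2 ⁻¹' cone ((T.invT.tr x s).1 ++ u) := by
    intro ρ
    rw [Set.mem_preimage, (hT s.2).apply_appendInf _ (hT _), heq]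
    exact prefixOf_append_iff _ _ _
  ext ρ
  constructor
  · intro hρ
    have hρ' : ρ ∈ T.inducedMap s.2 ⁻¹' cone (s.1 ++ [x]) := by
      have : PrefixOf ((s.1 ++ [x]) ++ u) (T.inducedMap s.2 ρ) := by
        rw [List.append_assoc]
        exact hρ
      exact this.of_append
    have h1 := (hl.1 ρ hρ').eq_appendInf
    refine ⟨_, ?_, h1.symm⟩
    rw [← hmem]
    exact h1 ▸ hρ
  · rintro ⟨σ, hσ, rfl⟩
    exact (hmem σ).2 hσ

lemma InvState.tr (hn : 2 ≤ n) (hT : ∀ q, T.Induces q (T.inducedMap q))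
    {s : List (Fin n) × T.Q} (hs : T.InvState s) (x : Fin n) : T.InvState (T.invT.tr x s) := by
  intro χ hχ
  have heq := hs.eq_append hn hT x
  have h1 : appendInf (T.outStar (T.invT.out x s) s.2) χ ∈ cone (s.1 ++ [x]) := by
    rw [heq]
    exact (prefixOf_append_iff _ _ _).2 hχ
  obtain ⟨ρ, hρ⟩ := hs.cone_append [x] h1
  have h2 : ρ ∈ T.inducedMap s.2 ⁻¹' cone (s.1 ++ [x]) := by
    rw [Set.mem_preimage, hρ]
    exact h1
  rw [hs.preimage_cone hn hT x []] at h2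
  obtain ⟨σ, -, rfl⟩ := h2
  rw [(hT s.2).apply_appendInf _ (hT _)] at hρ
  have := congrArg (shiftW (T.outStar (T.invT.out x s) s.2).length) hρ
  rw [shiftW_appendInf, shiftW_appendInf] at this
  exact ⟨σ, this⟩

lemma InvState.isLCP_outStar (hn : 2 ≤ n) (hT : ∀ q, T.Induces q (T.inducedMap q))
    {s : List (Fin n) × T.Q} (hs : T.InvState s) (x : Fin n) (u : List (Fin n)) :
    IsLCP (T.inducedMap s.2 ⁻¹' cone (s.1 ++ x :: u)) (T.invT.outStar (x :: u) s) := by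
  induction u generalizing s x with
  | nil =>
    show IsLCP _ (T.invT.out x s ++ [])
    rw [List.append_nil]
    exact isLCP_lcp hn (hs.cone_append [x])
  | cons y u ih =>
    rw [hs.preimage_cone hn hT]
    have hs' := hs.tr hn hT x
    exact (ih hs' y).appendInf_image
      ((preimage_cone_nontrivial hn (hs'.cone_append _)).nonempty) _

/-- A state `(w, q)` of the inverse transducer with `[w] ⊆ im(T_q)` induces the map
`χ ↦ (wχ)T_q⁻¹`. -/
lemma InvState.induces (hn : 2 ≤ n) (hT : ∀ q, T.Induces q (T.inducedMap q))
    {s : List (Fin n) × T.Q} (hs : T.InvState s) (hinj : Function.Injective (T.inducedMap s.2))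
    {g : Cantor n → Cantor n} (hg : ∀ χ, T.inducedMap s.2 (g χ) = appendInf s.1 χ) :
    T.invT.Induces s g := by
  intro χ m
  have hemb := (hT s.2).continuous.isClosedEmbedding hinj
  have hV : cone (takeW (g χ) m) ∈ nhds (g χ) := cone_mem_nhds (prefixOf_takeW _ _)
  rw [hemb.isInducing.nhds_eq_comap, Filter.mem_comap, hg] at hV
  obtain ⟨V, hV, hsub⟩ := hV
  obtain ⟨k, hk⟩ := exists_cone_subset hV
  have hcone : cone (s.1 ++ takeW χ (k + 1)) ⊆ V := by
    refine fun ψ hψ => hk ?_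
    obtain ⟨t, ht⟩ := (prefixOf_takeW (appendInf s.1 χ) k).prefix_of_length_le
      ((prefixOf_append_iff s.1 (takeW χ (k + 1)) χ).2 (prefixOf_takeW _ _))
      (by simp only [length_takeW, List.length_append]; omega)
    rw [ht] at hψ
    exact PrefixOf.of_append hψ
  have hx : ∃ x u, takeW χ (k + 1) = x :: u := by
    rcases hc : takeW χ (k + 1) with _ | ⟨x, u⟩
    · simpa [hc] using length_takeW χ (k + 1)
    · exact ⟨x, u, rfl⟩
  obtain ⟨x, u, hxu⟩ := hx
  have hl := hs.isLCP_outStar hn hT x u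
  rw [← hxu] at hl
  refine ⟨k + 1, ?_, hl.1 _ ?_⟩
  · have := hl.2 (takeW (g χ) m) fun ρ hρ => hsub (hcone hρ)
    rwa [length_takeW] at this
  · rw [Set.mem_preimage, hg]
    exact (prefixOf_append_iff _ _ _).2 (prefixOf_takeW _ _)

end Inverse

section Conjugation

variable {n : ℕ} {T : Transducer n} {q0 : T.Q} {h : Cantor n ≃ₜ Cantor n}

lemma induces_inducedMap (hAcc : T.Accessible q0) (hT : T.Induces q0 h) (q : T.Q) :
    T.Induces q (T.inducedMap q) := by
  obtain ⟨u, rfl⟩ := hAcc q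
  have := hT.transStar u
  rwa [inducedMap_eq this]

lemma inducedMap_injective (hAcc : T.Accessible q0) (hT : T.Induces q0 h) (q : T.Q) :
    Function.Injective (T.inducedMap q) := by
  have hq := induces_inducedMap hAcc hT q
  obtain ⟨u, rfl⟩ := hAcc q
  intro χ ψ hχψ
  have : h (appendInf u χ) = h (appendInf u ψ) := by
    rw [hT.apply_appendInf u hq, hT.apply_appendInf u hq, hχψ]
  have := congrArg (shiftW u.length) (h.injective this)
  rwa [shiftW_appendInf, shiftW_appendInf] at this

lemma invState_transStar (hn : 2 ≤ n) (hAcc : T.Accessible q0) (hT : T.Induces q0 h)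
    (w : List (Fin n)) {s : List (Fin n) × T.Q} (hs : T.InvState s) :
    T.InvState (T.invT.transStar w s) := by
  induction w generalizing s with
  | nil => exact hs
  | cons x w ih => exact ih (hs.tr hn (induces_inducedMap hAcc hT) x)

lemma invState_of_reach (hn : 2 ≤ n) (hAcc : T.Accessible q0) (hT : T.Induces q0 h)
    {s : List (Fin n) × T.Q} (hs : T.invT.reach ([], q0) s) : T.InvState s := by
  obtain ⟨w, rfl⟩ := hs
  refine invState_transStar hn hAcc hT w fun χ _ => ⟨h.symm χ, ?_⟩
  show T.inducedMap q0 _ = _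
  rw [inducedMap_eq hT, h.apply_symm_apply]

lemma invAcc_induces (hn : 2 ≤ n) (hAcc : T.Accessible q0) (hT : T.Induces q0 h)
    (s : (T.invAcc q0).Q) {g : Cantor n → Cantor n}
    (hg : ∀ χ, T.inducedMap s.1.2 (g χ) = appendInf s.1.1 χ) : (T.invAcc q0).Induces s g := by
  have := (invState_of_reach hn hAcc hT s.2).induces hn (induces_inducedMap hAcc hT)
    (inducedMap_injective hAcc hT _) hg
  intro χ m
  obtain ⟨k, hk⟩ := this χ m
  refine ⟨k, ?_⟩
  have he := restrictTo_outStar (T := T.invT) reach_tr (takeW χ k) s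
  exact ⟨hk.1.trans_eq (congrArg List.length he.symm), he.symm ▸ hk.2⟩

lemma exists_invAcc_induces (hn : 2 ≤ n) (hAcc : T.Accessible q0) (hT : T.Induces q0 h)
    (s : (T.invAcc q0).Q) : ∃ g : Cantor n → Cantor n, (T.invAcc q0).Induces s g ∧
      ∀ χ, T.inducedMap s.1.2 (g χ) = appendInf s.1.1 χ := by
  have hex : ∀ χ, ∃ ρ, T.inducedMap s.1.2 ρ = appendInf s.1.1 χ :=
    fun χ => invState_of_reach hn hAcc hT s.2 (prefixOf_appendInf _ χ)
  choose g hg using hex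
  exact ⟨g, invAcc_induces hn hAcc hT s hg, hg⟩

/-- The initial state of the inverse transducer. -/
def invInit (T : Transducer n) (q0 : T.Q) : (T.invAcc q0).Q := ⟨([], q0), [], rfl⟩

lemma invInit_induces (hn : 2 ≤ n) (hAcc : T.Accessible q0) (hT : T.Induces q0 h) :
    (T.invAcc q0).Induces (T.invInit q0) h.symm := by
  refine invAcc_induces hn hAcc hT _ fun χ => ?_
  show T.inducedMap q0 _ = appendInf [] χ
  rw [inducedMap_eq hT, h.apply_symm_apply, appendInf_nil]

/-- The homeomorphisms `g` for which `h g h⁻¹` locally only changes prefixes. -/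
def localPrefixGroup (h : Cantor n ≃ₜ Cantor n) : Subgroup (Cantor n ≃ₜ Cantor n) where
  carrier := {g | ∀ x, TailEq x (h ∘ g) h}
  mul_mem' {f g} hf hg x := ((hf (g x)).comp g.continuous).trans (hg x)
  one_mem' _ := ⟨0, 0, .of_forall fun _ => rfl⟩
  inv_mem' {g} hg x := by
    have := ((hg (g.symm x)).comp g.symm.continuous).symm
    have he : (h ∘ g) ∘ g.symm = h := by
      funext y
      simp
    rwa [he] at this

lemma IsCompletion.mem_localPrefixGroup (hn : 2 ≤ n) (hAcc : T.Accessible q0)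
    (hT : T.Induces q0 h) (hSync : T.Synchronizing) {g : Cantor n ≃ₜ Cantor n}
    (hg : (T.prod (T.invAcc q0)).IsCompletion g) : g ∈ localPrefixGroup h := by
  obtain ⟨l, η, ρ, p, f, -, hη, hf, -, -, hgf⟩ := hg
  intro x
  have hI := induces_inducedMap hAcc hT
  obtain ⟨i, hi, -⟩ := hη x
  obtain ⟨S, hS, hST⟩ := exists_invAcc_induces hn hAcc hT (p i).2
  have hfi : f i = S ∘ T.inducedMap (p i).1 := (hf i).unique ((hI (p i).1).prod hS)
  set φ : Cantor n → Cantor n := shiftW (η i).length with hφ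
  have hφc : Continuous φ := continuous_shiftW _
  have hxη : ∀ᶠ z in nhds x, z = appendInf (η i) (φ z) :=
    Filter.mem_of_superset (cone_mem_nhds hi) fun z hz => PrefixOf.eq_appendInf hz
  have hfc : Continuous (f i ∘ φ) := (hf i).continuous.comp hφc
  have h1 : TailEq x h (T.inducedMap (T.transStar (η i) q0) ∘ φ) := by
    refine .of_eventually (T.outStar (η i) q0) (hxη.mono fun z hz => ?_)
    conv_lhs => rw [hz]
    exact hT.apply_appendInf _ (hI _) _
  have h2 : TailEq x (T.inducedMap (T.transStar (η i) q0) ∘ φ) (T.inducedMap (p i).1 ∘ φ) :=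
    (hSync.tailEq (hI _) (hI _) (φ x)).comp hφc
  have h3 : TailEq x (h ∘ g) (T.inducedMap (T.transStar (ρ i) q0) ∘ (f i ∘ φ)) := by
    refine .of_eventually (T.outStar (ρ i) q0) (hxη.mono fun z hz => ?_)
    show h (g z) = _
    rw [hz, hgf, hT.apply_appendInf _ (hI _), ← hz]
    rfl
  have h4 : TailEq x (T.inducedMap (T.transStar (ρ i) q0) ∘ (f i ∘ φ))
      (T.inducedMap (p i).2.1.2 ∘ (f i ∘ φ)) :=
    (hSync.tailEq (hI _) (hI _) _).comp hfc
  have h5 : TailEq x (T.inducedMap (p i).2.1.2 ∘ (f i ∘ φ)) (T.inducedMap (p i).1 ∘ φ) :=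
    .of_eventually (p i).2.1.1 (.of_forall fun z => by rw [hfi]; exact hST _)
  exact (h3.trans (h4.trans h5)).trans (h1.trans h2).symm

lemma localPrefixGroup_subset (hn : 2 ≤ n) (h : Cantor n ≃ₜ Cantor n) :
    (localPrefixGroup h : Set (Cantor n ≃ₜ Cantor n)) ⊆ paperConj h.symm '' Vn n := by
  intro g hg
  refine ⟨(h.symm.trans g).trans h, mem_Vn_of_tailEq hn _ fun y => ?_, ?_⟩
  · have := (hg (h.symm y)).comp h.symm.continuous
    have he : h ∘ h.symm = id := h.self_comp_symm
    rwa [he] at this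
  · ext1 x
    simp [paperConj]

/-- Conjugates of elements of `Vₙ` are completions of the product transducer. -/
lemma isCompletion_paperConj (hn : 2 ≤ n) (hAcc : T.Accessible q0) (hT : T.Induces q0 h)
    {v : Cantor n ≃ₜ Cantor n} (hv : v ∈ Vn n) :
    (T.prod (T.invAcc q0)).IsCompletion (paperConj h.symm v) := by
  have hI := induces_inducedMap hAcc hT
  obtain ⟨m, α, β, hα, -, hvαβ⟩ := hv
  have key : ∃ L, ∀ x : Cantor n, ∃ γ, ∀ χ, v (h (appendInf (takeW x L) χ)) =
      appendInf γ (T.inducedMap (T.transStar (takeW x L) q0) χ) := by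
    refine exists_uniform_length (P := fun w => ∃ γ, ∀ χ, v (h (appendInf w χ)) =
      appendInf γ (T.inducedMap (T.transStar w q0) χ)) ?_ fun x => ?_
    · rintro a b ⟨γ, hγ⟩
      refine ⟨γ ++ T.outStar b (T.transStar a q0), fun χ => ?_⟩
      rw [appendInf_append, hγ, appendInf_append, transStar_append,
        ← (hI _).apply_appendInf b (hI _)]
    · obtain ⟨i, hi, -⟩ := hα (h x)
      obtain ⟨k, hk, hpre⟩ := hT x (α i).length
      obtain ⟨t, ht⟩ := PrefixOf.prefix_of_length_le hi hpre hk
      refine ⟨k, β i ++ t, fun χ => ?_⟩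
      rw [hT.apply_appendInf _ (hI _), ht, appendInf_append, hvαβ, appendInf_append]
  obtain ⟨L, hL⟩ := key
  have hex : ∀ i : Fin (n ^ L), ∃ γ, ∀ χ, v (h (appendInf (wordFam n L i) χ)) =
      appendInf γ (T.inducedMap (T.transStar (wordFam n L i) q0) χ) := by
    intro i
    obtain ⟨y, hy⟩ := exists_takeW_eq_wordFam hn L i
    rw [← hy]
    exact hL y
  choose γ hγ using hex
  set S := T.invAcc q0 with hS
  choose g hg _ using fun s => exists_invAcc_induces hn hAcc hT s
  have hf : ∀ i χ, paperConj h.symm v (appendInf (wordFam n L i) χ) =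
      appendInf (S.outStar (γ i) (T.invInit q0))
        (g (S.transStar (γ i) (T.invInit q0))
          (T.inducedMap (T.transStar (wordFam n L i) q0) χ)) := by
    intro i χ
    show h.symm (v (h _)) = _
    rw [hγ, (invInit_induces hn hAcc hT).apply_appendInf _ (hg _)]
  refine ⟨n ^ L, wordFam n L, fun i => S.outStar (γ i) (T.invInit q0),
    fun i => (T.transStar (wordFam n L i) q0, S.transStar (γ i) (T.invInit q0)),
    fun i => g (S.transStar (γ i) (T.invInit q0)) ∘
      T.inducedMap (T.transStar (wordFam n L i) q0), ?_, antichainFam_wordFam n L,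
    fun i => (hI _).prod (hg _), ?_, ?_, hf⟩
  · have h1 : n ≡ 1 [MOD n - 1] := ((Nat.modEq_iff_dvd' (by omega)).2 dvd_rfl).symm
    simpa [Nat.ModEq] using h1.pow L
  · refine Set.eq_univ_of_forall fun y => ?_
    obtain ⟨x, rfl⟩ := (paperConj h.symm v).surjective y
    obtain ⟨i, hi, -⟩ := antichainFam_wordFam n L x
    refine Set.mem_iUnion.2 ⟨i, _, ⟨shiftW (wordFam n L i).length x, rfl⟩, ?_⟩
    conv_rhs => rw [PrefixOf.eq_appendInf hi]
    exact (hf i _).symm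
  · intro i j hij
    rw [Set.disjoint_left]
    rintro _ ⟨_, ⟨χ, rfl⟩, rfl⟩ ⟨_, ⟨ψ, rfl⟩, hψ⟩
    have h1 := (paperConj h.symm v).injective ((hf j ψ).trans (hψ.trans (hf i χ).symm))
    refine hij ((antichainFam_wordFam n L (appendInf (wordFam n L i) χ)).unique
      (prefixOf_appendInf _ _) ?_)
    show PrefixOf _ _
    rw [← h1]
    exact prefixOf_appendInf _ _

end Conjugation

end Transducer

/-- Theorem 5.9. Let `T_{q0}` be a minimal, one-way synchronizing
initial transducer representing a homeomorphism `h` of Cantor space, with inverse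
`S_{(ε,q0)}`.  Then `Vₙ^{T_{q0}⁻¹} = 𝓗(TS)`, where
`Vₙ^{T_{q0}⁻¹} = T_{q0} Vₙ T_{q0}⁻¹`. -/
theorem conjugate_overgroup_eq_HGroup
    {n : ℕ} (hn : 2 ≤ n) (T : Transducer n) [Finite T.Q] (q0 : T.Q)
    (h : Cantor n ≃ₜ Cantor n) (hMin : T.Minimal) (hAcc : T.Accessible q0)
    (hOne : T.OneWaySync q0 h) :
    paperConj h.symm '' Vn n = ↑(Transducer.HGroup (T.prod (T.invAcc q0))) := by
  refine Set.Subset.antisymm ?_ (Set.Subset.trans ?_ (Transducer.localPrefixGroup_subset hn h))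
  · rintro _ ⟨v, hv, rfl⟩
    exact Subgroup.subset_closure (Transducer.isCompletion_paperConj hn hAcc hOne.1 hv)
  · exact (Subgroup.closure_le _).2 fun g hg =>
      hg.mem_localPrefixGroup hn hAcc hOne.1 hOne.2.1
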